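/- arXiv:1910.04147 — 6 statements merged into one kernel-verified Lean document; each statement's English description precedes it below -/
import Mathlib

section
/- Let f ∈ ℝ[X,Y] with f ≥ 0 on the strip [0,1]×ℝ and deg_Y f ≤ 2. Then there exist sums of squares σ₀, σ₁ in ℝ[X,Y] such that f = σ₀ + σ₁·X(1−X) and deg(σ₀) ≤ deg_X f + 3 and deg(σ₁·X(1−X)) ≤ deg_X f + 3. -/
section PSDMatrix

open Polynomial

/-- `IsSumRankOne S a b c` says that the symmetric matrix `!![a, b; b, c]` is a finite sum of
matrices `v * vᵀ` where `v` is a vector with two entries in `S`. -/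
inductive IsSumRankOne (S : Set ℝ[X]) : ℝ[X] → ℝ[X] → ℝ[X] → Prop
  | zero : IsSumRankOne S 0 0 0
  | add {p q a b c : ℝ[X]} (hp : p ∈ S) (hq : q ∈ S) (h : IsSumRankOne S a b c) :
      IsSumRankOne S (p * p + a) (p * q + b) (q * q + c)

/-- The symmetric matrix `!![a, b; b, c]` is positive semidefinite at every real point. -/
structure IsPSD (a b c : ℝ[X]) : Prop where
  left (x : ℝ) : 0 ≤ a.eval x
  right (x : ℝ) : 0 ≤ c.eval x
  det (x : ℝ) : 0 ≤ (a * c - b ^ 2).eval x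

namespace IsSumRankOne

variable {S : Set ℝ[X]} {a b c : ℝ[X]}

theorem swap (h : IsSumRankOne S a b c) : IsSumRankOne S c b a := by
  induction h with
  | zero => exact zero
  | @add p q _ _ _ hp hq _ ih => exact mul_comm q p ▸ add hq hp ih

theorem shear (g : ℝ[X]) (h : IsSumRankOne Set.univ a b c) :
    IsSumRankOne Set.univ a (b + g * a) (c + 2 * g * b + g ^ 2 * a) := by
  induction h with
  | zero => simpa using zero
  | @add p q a b c _ _ _ ih =>
    convert add (Set.mem_univ p) (Set.mem_univ (q + g * p)) ih using 1 <;> ring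

theorem scale (g : ℝ[X]) (h : IsSumRankOne Set.univ a b c) :
    IsSumRankOne Set.univ a (g * b) (g ^ 2 * c) := by
  induction h with
  | zero => simpa using zero
  | @add p q a b c _ _ _ ih =>
    convert add (Set.mem_univ p) (Set.mem_univ (g * q)) ih using 1 <;> ring

theorem of_isSumSq (h : IsSumSq c) : IsSumRankOne Set.univ 0 0 c := by
  induction h with
  | zero => exact zero
  | sq_add q _ ih => simpa using add (Set.mem_univ 0) (Set.mem_univ q) ih

theorem nonneg (h : IsSumRankOne S a b c) (x : ℝ) : 0 ≤ a.eval x := by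
  induction h with
  | zero => simp
  | add _ _ _ ih => simpa using add_nonneg (mul_self_nonneg _) ih

end IsSumRankOne

theorem Polynomial.eval_nonneg_of_forall_ne {p : ℝ[X]} {t : ℝ} (h : ∀ x ≠ t, 0 ≤ p.eval x)
    (x : ℝ) : 0 ≤ p.eval x := by
  have hc : IsClosed {x : ℝ | 0 ≤ p.eval x} := isClosed_le continuous_const p.continuous
  have := (dense_compl_singleton t).mono (s₂ := {x : ℝ | 0 ≤ p.eval x}) fun x hx => h x hx
  exact (hc.closure_eq ▸ this.closure_eq ▸ Set.mem_univ x : x ∈ {x : ℝ | 0 ≤ p.eval x})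

theorem Polynomial.eval_nonneg_of_sq_mul {p : ℝ[X]} {t : ℝ}
    (h : ∀ x, 0 ≤ ((X - C t) ^ 2 * p).eval x) (x : ℝ) : 0 ≤ p.eval x := by
  refine eval_nonneg_of_forall_ne (t := t) (fun y hy => ?_) x
  have h1 := h y
  simp only [eval_mul, eval_pow, eval_sub, eval_X, eval_C] at h1
  exact nonneg_of_mul_nonneg_right h1 (by have := sub_ne_zero.2 hy; positivity)

theorem Polynomial.sq_dvd_of_nonneg {p : ℝ[X]} {t : ℝ} (h : ∀ x, 0 ≤ p.eval x)
    (ht : p.eval t = 0) : (X - C t) ^ 2 ∣ p := by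
  rcases eq_or_ne p 0 with rfl | hp
  · simp
  rw [← le_rootMultiplicity_iff hp]
  refine (one_lt_rootMultiplicity_iff_isRoot hp).2 ⟨ht, ?_⟩
  have hmin : IsLocalMin (fun x => p.eval x) t := Filter.Eventually.of_forall fun x => by
    simpa [ht] using h x
  exact hmin.hasDerivAt_eq_zero (p.hasDerivAt t)

theorem Polynomial.natDegree_lt_of_sq_mul {p q : ℝ[X]} {t : ℝ} (h : p = (X - C t) ^ 2 * q)
    (hp : p ≠ 0) : q.natDegree < p.natDegree := by
  have hq : q ≠ 0 := by rintro rfl; simp at h; exact hp h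
  rw [h, natDegree_mul (pow_ne_zero _ (X_sub_C_ne_zero t)) hq, natDegree_pow, natDegree_X_sub_C]
  omega

theorem Polynomial.isSumSq_of_nonneg {p : ℝ[X]} (h : ∀ x, 0 ≤ p.eval x) : IsSumSq p := by
  induction hn : p.natDegree using Nat.strong_induction_on generalizing p with
  | _ n ih =>
  have hC : ∀ r : ℝ, 0 ≤ r → IsSumSq (C r) := fun r hr => by
    simpa [← C_mul, Real.mul_self_sqrt hr] using IsSumSq.mul_self (C (Real.sqrt r))
  rcases Nat.eq_zero_or_pos n with rfl | hpos
  · rw [eq_C_of_natDegree_eq_zero hn] at h ⊢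
    exact hC _ (by simpa using h 0)
  obtain ⟨t, ht⟩ := p.exists_forall_norm_le
  simp only [Real.norm_eq_abs, abs_of_nonneg (h _)] at ht
  obtain ⟨q, hq⟩ := sq_dvd_of_nonneg (p := p - C (p.eval t)) (t := t)
    (fun x => by simpa using ht x) (by simp)
  have hdeg : (p - C (p.eval t)).natDegree = n := by rw [natDegree_sub_C, hn]
  have hlt := natDegree_lt_of_sq_mul hq (by rintro h0; rw [h0] at hdeg; simp at hdeg; omega)
  have hqs := ih _ (hdeg ▸ hlt) (eval_nonneg_of_sq_mul (t := t) (p := q)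
    (fun x => by rw [← hq]; simpa using ht x)) rfl
  have : p = C (p.eval t) + (X - C t) * (X - C t) * q := by
    rw [← sq, ← hq]; ring
  rw [this]
  exact (hC _ (h t)).add ((IsSumSq.mul_self _).mul hqs)

namespace IsPSD

variable {a b c : ℝ[X]}

theorem swap (h : IsPSD a b c) : IsPSD c b a :=
  ⟨h.right, h.left, fun x => by rw [mul_comm]; exact h.det x⟩

theorem shear (h : IsPSD a b c) (g : ℝ[X]) :
    IsPSD a (b + g * a) (c + 2 * g * b + g ^ 2 * a) := by
  refine ⟨h.left, fun x => ?_, fun x => ?_⟩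
  · have h1 := h.left x
    have h2 := h.right x
    have h3 := h.det x
    simp only [eval_add, eval_mul, eval_pow, eval_sub, eval_ofNat] at *
    rcases h1.eq_or_lt with h0 | h0
    · rw [← h0] at h3 ⊢
      have : b.eval x = 0 := by nlinarith
      simpa [this] using h2
    · refine nonneg_of_mul_nonneg_right (a := a.eval x) ?_ h0
      nlinarith [sq_nonneg (b.eval x + g.eval x * a.eval x)]
  · convert h.det x using 2
    ring

theorem isSumRankOne_of_right_root {t : ℝ} (h : IsPSD a b c) (ht : c.eval t = 0)
    (h0 : a * c - b ^ 2 ≠ 0)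
    (ih : ∀ a' b' c', IsPSD a' b' c' → (a' * c' - b' ^ 2).natDegree < (a * c - b ^ 2).natDegree →
      IsSumRankOne Set.univ a' b' c') : IsSumRankOne Set.univ a b c := by
  obtain ⟨c', rfl⟩ := sq_dvd_of_nonneg h.right ht
  have hb : b.IsRoot t := by
    have := h.det t
    simp only [eval_sub, eval_mul, ht, eval_pow] at this
    rw [IsRoot.def]
    nlinarith
  obtain ⟨b', rfl⟩ := dvd_iff_isRoot.2 hb
  have hdet : a * ((X - C t) ^ 2 * c') - ((X - C t) * b') ^ 2 =
    (X - C t) ^ 2 * (a * c' - b' ^ 2) := by ring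
  refine (ih a b' c' ⟨h.left, eval_nonneg_of_sq_mul h.right, ?_⟩
    (natDegree_lt_of_sq_mul hdet h0)).scale _
  exact eval_nonneg_of_sq_mul (hdet ▸ h.det)

theorem isSumRankOne_of_det_root {t : ℝ} (h : IsPSD a b c) (ht : (a * c - b ^ 2).eval t = 0)
    (h0 : a * c - b ^ 2 ≠ 0)
    (ih : ∀ a' b' c', IsPSD a' b' c' → (a' * c' - b' ^ 2).natDegree < (a * c - b ^ 2).natDegree →
      IsSumRankOne Set.univ a' b' c') : IsSumRankOne Set.univ a b c := by
  by_cases ha : a.eval t = 0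
  · exact (h.swap.isSumRankOne_of_right_root ha (by rwa [mul_comm])
      (by rwa [mul_comm c a])).swap
  set g : ℝ[X] := C (-(b.eval t / a.eval t)) with hg
  have hdet : a * (c + 2 * g * b + g ^ 2 * a) - (b + g * a) ^ 2 = a * c - b ^ 2 := by ring
  have key := (h.shear g).isSumRankOne_of_right_root (t := t) ?_ (by rwa [hdet])
    (by rwa [hdet])
  · convert key.shear (-g) using 1 <;> ring
  · simp only [hg, eval_add, eval_mul, eval_pow, eval_sub, eval_ofNat, eval_C] at ht ⊢
    field_simp
    linear_combination ht

theorem eq_zero_of_left_eq_zero (h : IsPSD 0 b c) : b = 0 := by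
  refine Polynomial.funext fun x => ?_
  have := h.det x
  simp only [eval_sub, eval_mul, eval_pow, eval_zero] at this ⊢
  nlinarith

theorem isSumRankOne_of_reduced
    (h : IsPSD a b c)
    (H : ∀ a' b' c', IsPSD a' b' c' → a' * c' - b' ^ 2 = a * c - b ^ 2 → a' ≠ 0 →
      b'.degree < a'.degree → a'.natDegree ≤ c'.natDegree → IsSumRankOne Set.univ a' b' c') :
    IsSumRankOne Set.univ a b c := by
  induction hn : a.natDegree using Nat.strong_induction_on generalizing a b c with
  | _ n ih =>
  rcases eq_or_ne a 0 with rfl | ha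
  · obtain rfl := h.eq_zero_of_left_eq_zero
    exact .of_isSumSq (isSumSq_of_nonneg h.right)
  set g : ℝ[X] := -(b / a) with hg
  have hb : b + g * a = b % a := by
    linear_combination -(EuclideanDomain.div_add_mod b a)
  have h' := h.shear g
  have hdet : a * (c + 2 * g * b + g ^ 2 * a) - (b + g * a) ^ 2 = a * c - b ^ 2 := by ring
  have key : IsSumRankOne Set.univ a (b + g * a) (c + 2 * g * b + g ^ 2 * a) := by
    rcases le_or_gt a.natDegree (c + 2 * g * b + g ^ 2 * a).natDegree with hle | hlt
    · exact H _ _ _ h' hdet ha (hb ▸ EuclideanDomain.mod_lt b ha) hle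
    · exact (ih _ (hn ▸ hlt) h'.swap
        (by rw [mul_comm (c + 2 * g * b + g ^ 2 * a) a, hdet]; exact H) rfl).swap
  convert key.shear (-g) using 1 <;> ring

/-- Subtracting from a positive definite matrix the largest possible multiple of a constant
rank one matrix makes its determinant vanish somewhere. -/
theorem exists_sub_det_root (h : IsPSD a b c) (hdet : ∀ t, (a * c - b ^ 2).eval t ≠ 0)
    (hdeg : c.degree < (a * c - b ^ 2).degree) :
    ∃ r t : ℝ, 0 ≤ r ∧ IsPSD (a - C r) b c ∧ ((a - C r) * c - b ^ 2).eval t = 0 := by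
  have hpos : ∀ x, 0 < (a * c - b ^ 2).eval x := fun x => (h.det x).lt_of_ne' (hdet x)
  have hc : ∀ x, 0 < c.eval x := fun x => (h.right x).lt_of_ne' fun h0 => by
    have := hpos x
    simp only [eval_sub, eval_mul, eval_pow, h0] at this
    nlinarith
  obtain ⟨t, ht⟩ : ∃ t, ∀ x, (a * c - b ^ 2).eval t / c.eval t ≤
      (a * c - b ^ 2).eval x / c.eval x := by
    refine Continuous.exists_forall_le'
      ((Polynomial.continuous _).div c.continuous fun x => (hc x).ne') 0 ?_
    have hr : 0 < c.eval 0 / (a * c - b ^ 2).eval 0 := div_pos (hc 0) (hpos 0)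
    have := (isLittleO_cobounded_of_degree_lt hdeg).bound hr
    rw [Metric.cobounded_eq_cocompact] at this
    filter_upwards [this] with x hx
    rw [Real.norm_of_nonneg (hc x).le, Real.norm_of_nonneg (hpos x).le, div_mul_eq_mul_div,
      le_div_iff₀ (hpos 0)] at hx
    rw [div_le_div_iff₀ (hc 0) (hc x)]
    linarith
  set r := (a * c - b ^ 2).eval t / c.eval t with hr
  have hev : ∀ x, ((a - C r) * c - b ^ 2).eval x = (a * c - b ^ 2).eval x - r * c.eval x :=
    fun x => by simp only [eval_sub, eval_mul, eval_pow, eval_C]; ring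
  have hdet' : ∀ x, 0 ≤ ((a - C r) * c - b ^ 2).eval x := fun x => by
    rw [hev, sub_nonneg, ← le_div_iff₀ (hc x)]
    exact ht x
  refine ⟨r, t, div_nonneg (h.det t) (h.right t), ⟨fun x => ?_, h.right, hdet'⟩, ?_⟩
  · have := hdet' x
    rw [eval_sub, eval_mul, eval_pow] at this
    exact nonneg_of_mul_nonneg_left (by nlinarith [sq_nonneg (b.eval x)]) (hc x)
  · rw [hev, hr, div_mul_cancel₀ _ (hc t).ne', sub_self]

theorem isSumRankOne_C {r : ℝ} (hr : 0 < r) (h : IsPSD (C r) b c) :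
    IsSumRankOne Set.univ (C r) b c := by
  have hrr : C r * C r⁻¹ = (1 : ℝ[X]) := by rw [← C_mul, mul_inv_cancel₀ hr.ne', C_1]
  have key : IsSumRankOne Set.univ (C r) 0 (c - C r⁻¹ * b ^ 2) := by
    have h1 := (IsSumRankOne.of_isSumSq (c := c - C r⁻¹ * b ^ 2)
      (isSumSq_of_nonneg fun x => ?_)).add (Set.mem_univ (C (Real.sqrt r))) (Set.mem_univ 0)
    · simpa [← C_mul, Real.mul_self_sqrt hr.le] using h1
    · have := h.det x
      simp only [eval_sub, eval_mul, eval_pow, eval_C] at this ⊢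
      refine nonneg_of_mul_nonneg_right (a := r) ?_ hr
      field_simp
      linarith
  convert key.shear (C r⁻¹ * b) using 1
  · linear_combination -b * hrr
  · linear_combination -(C r⁻¹ * b ^ 2) * hrr

theorem isSumRankOne (h : IsPSD a b c) : IsSumRankOne Set.univ a b c := by
  induction hn : (a * c - b ^ 2).natDegree using Nat.strong_induction_on generalizing a b c with
  | _ n ih =>
  refine h.isSumRankOne_of_reduced fun a₁ b₁ c₁ h₁ hD ha hba hac => ?_
  rw [← hD] at hn
  clear hD h a b c
  rename' a₁ => a, b₁ => b, c₁ => c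
  have ih' : ∀ a' b' c', IsPSD a' b' c' → (a' * c' - b' ^ 2).natDegree < n →
      IsSumRankOne Set.univ a' b' c' := fun a' b' c' h' hlt => ih _ hlt h' rfl
  rcases Nat.eq_zero_or_pos a.natDegree with h0 | hpos
  · rw [eq_C_of_natDegree_eq_zero h0] at h₁ ha ⊢
    refine h₁.isSumRankOne_C (lt_of_le_of_ne (by simpa using h₁.left 0) ?_)
    rintro h2
    rw [← h2] at ha
    simp at ha
  have hc0 : c ≠ 0 := by rintro rfl; simp at hac; omega
  have hdet : (a * c - b ^ 2).degree = a.degree + c.degree := by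
    rw [degree_sub_eq_left_of_degree_lt, degree_mul]
    have hcd : a.degree ≤ c.degree := by
      rw [degree_eq_natDegree ha, degree_eq_natDegree hc0]; exact_mod_cast hac
    rcases eq_or_ne b 0 with rfl | hb0
    · rw [zero_pow two_ne_zero, degree_zero, bot_lt_iff_ne_bot, Ne, degree_eq_bot]
      exact mul_ne_zero ha hc0
    rw [sq, degree_mul, degree_mul]
    rw [degree_eq_natDegree ha, degree_eq_natDegree hc0, degree_eq_natDegree hb0] at *
    norm_cast at *
    omega
  have hlt : c.degree < (a * c - b ^ 2).degree := by
    rw [hdet, degree_eq_natDegree ha, degree_eq_natDegree hc0]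
    norm_cast
    omega
  have hD0 : a * c - b ^ 2 ≠ 0 := ne_zero_of_degree_gt hlt
  by_cases hroot : ∃ t, (a * c - b ^ 2).eval t = 0
  · obtain ⟨t, ht⟩ := hroot
    exact h₁.isSumRankOne_of_det_root ht hD0 (by rwa [hn])
  push Not at hroot
  obtain ⟨r, t, hr, h₂, ht⟩ := h₁.exists_sub_det_root hroot hlt
  have hdeg : ((a - C r) * c - b ^ 2).degree = (a * c - b ^ 2).degree := by
    have : (a - C r) * c - b ^ 2 = (a * c - b ^ 2) - C r * c := by ring
    rw [this]
    exact degree_sub_eq_left_of_degree_lt (by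
      rw [← smul_eq_C_mul]
      exact (degree_smul_le r c).trans_lt hlt)
  have key := h₂.isSumRankOne_of_det_root ht
    (fun h0 => hD0 (by rw [← degree_eq_bot, ← hdeg, h0, degree_zero]))
    (by rwa [natDegree_eq_of_degree_eq hdeg, hn])
  simpa [← C_mul, Real.mul_self_sqrt hr] using
    key.add (Set.mem_univ (C (Real.sqrt r))) (Set.mem_univ 0)

end IsPSD

theorem Polynomial.natDegree_le_of_eval_le {p q : ℝ[X]} (h0 : ∀ x, 0 ≤ p.eval x)
    (h : ∀ x, p.eval x ≤ q.eval x) : p.natDegree ≤ q.natDegree := by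
  by_contra! hlt
  have hp : 0 < p.degree := natDegree_pos_iff_degree_pos.1 (by omega)
  have hqp : q.degree < p.degree := degree_lt_degree hlt
  have h1 := (isLittleO_atTop_of_degree_lt q p hqp).bound (by norm_num : (0 : ℝ) < 1 / 2)
  have h2 := eventually_atTop_not_isRoot p (ne_zero_of_degree_gt hp)
  obtain ⟨x, hx1, hx2⟩ := (h1.and h2).exists
  have h3 : 0 < p.eval x := (h0 x).lt_of_ne' hx2
  rw [Real.norm_of_nonneg (h0 x), Real.norm_of_nonneg ((h0 x).trans (h x))] at hx1
  linarith [h x]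

theorem IsSumRankOne.natDegree_le {a b c : ℝ[X]} {n : ℕ} (h : IsSumRankOne Set.univ a b c)
    (ha : a.natDegree ≤ 2 * n) (hc : c.natDegree ≤ 2 * n) :
    IsSumRankOne {p | p.natDegree ≤ n} a b c := by
  have aux : ∀ p s : ℝ[X], (∀ x, 0 ≤ s.eval x) → (p * p + s).natDegree ≤ 2 * n →
      p.natDegree ≤ n ∧ s.natDegree ≤ 2 * n := fun p s hs hps => by
    have h1 : (p * p).natDegree ≤ (p * p + s).natDegree := natDegree_le_of_eval_le
      (fun x => by rw [eval_mul]; exact mul_self_nonneg _)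
      (fun x => by simpa using hs x)
    have h2 : s.natDegree ≤ (p * p + s).natDegree := natDegree_le_of_eval_le hs
      (fun x => by rw [eval_add, eval_mul]; exact le_add_of_nonneg_left (mul_self_nonneg _))
    rw [← sq, natDegree_pow, sq] at h1
    omega
  induction h with
  | zero => exact zero
  | add _ _ h ih =>
    obtain ⟨hp, ha⟩ := aux _ _ h.nonneg ha
    obtain ⟨hq, hc⟩ := aux _ _ h.swap.nonneg hc
    exact add hp hq (ih ha hc)

/-- A polynomial in `t`, after the substitution `t = w / z` where `w ^ 2 + z ^ 2 = 1`, splits into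
a part which is even in `w` and a part which is odd in `w`. -/
theorem Polynomial.exists_even_odd {p : ℝ[X]} {m : ℕ} (hp : p.natDegree ≤ 2 * m) :
    ∃ e o : ℝ[X], e.natDegree ≤ m ∧ o.degree < m ∧ ∀ w z : ℝ, w ^ 2 + z ^ 2 = 1 → z ≠ 0 →
      p.eval (w / z) * z ^ (2 * m) = e.eval (w ^ 2) + w * z * o.eval (w ^ 2) := by
  have hX : (1 - X : ℝ[X]).natDegree ≤ 1 := by
    simpa using natDegree_sub_le (1 : ℝ[X]) X
  have hdeg : ∀ (r : ℝ) (i j : ℕ), (C r * X ^ i * (1 - X) ^ j : ℝ[X]).natDegree ≤ i + j :=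
    fun r i j => natDegree_mul_le.trans
      (add_le_add (natDegree_C_mul_X_pow_le r i) (by simpa using natDegree_pow_le_of_le j hX))
  have hlt : ∀ (r : ℝ) (i : ℕ), i < m →
      (C r * X ^ i * (1 - X) ^ (m - 1 - i) : ℝ[X]).degree < m := fun r i hi =>
    degree_le_natDegree.trans_lt (by
      exact_mod_cast (hdeg r i (m - 1 - i)).trans_lt (by omega))
  refine ⟨∑ i ∈ Finset.range (m + 1), C (p.coeff (2 * i)) * X ^ i * (1 - X) ^ (m - i),
    ∑ i ∈ Finset.range m, C (p.coeff (2 * i + 1)) * X ^ i * (1 - X) ^ (m - 1 - i), ?_, ?_, ?_⟩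
  · exact natDegree_sum_le_of_forall_le _ _ fun i hi => (hdeg _ _ _).trans
      (by have := Finset.mem_range.1 hi; omega)
  · rw [← mem_degreeLT]
    exact Submodule.sum_mem _ fun i hi => mem_degreeLT.2 (hlt _ _ (Finset.mem_range.1 hi))
  · intro w z hwz hz
    have hz2 : 1 - w ^ 2 = z ^ 2 := by linarith
    have hsum : ∀ F : ℕ → ℝ, ∑ i ∈ Finset.range (2 * m + 1), F i =
        ∑ i ∈ Finset.range (m + 1), F (2 * i) + ∑ i ∈ Finset.range m, F (2 * i + 1) := by
      intro F
      clear * -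
      induction m with
      | zero => simp
      | succ k ih =>
        rw [show 2 * (k + 1) + 1 = 2 * k + 1 + 1 + 1 by ring, Finset.sum_range_succ,
          Finset.sum_range_succ, ih, Finset.sum_range_succ _ (k + 1),
          Finset.sum_range_succ _ k, Finset.sum_range_succ (fun i => F (2 * i + 1)) k]
        ring_nf
    rw [eval_eq_sum_range' (n := 2 * m + 1) (by omega), Finset.sum_mul, hsum, eval_finsetSum,
      eval_finsetSum, Finset.mul_sum]
    congr 1 <;> refine Finset.sum_congr rfl fun i hi => ?_ <;>
      rw [Finset.mem_range] at hi <;>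
      simp only [eval_mul, eval_C, eval_pow, eval_X, eval_sub, eval_one, hz2, div_pow]
    · obtain ⟨k, rfl⟩ : ∃ k, m = i + k := ⟨m - i, by omega⟩
      rw [Nat.add_sub_cancel_left]
      field_simp
      ring
    · obtain ⟨k, rfl⟩ : ∃ k, m = i + 1 + k := ⟨m - (i + 1), by omega⟩
      rw [show i + 1 + k - 1 - i = k by omega]
      field_simp
      ring

theorem Polynomial.exists_homogenize {a : ℝ[X]} {n : ℕ} (ha : a.natDegree ≤ n) :
    ∃ A : ℝ[X], A.natDegree ≤ 2 * n ∧ ∀ w z : ℝ, w ^ 2 + z ^ 2 = 1 → z ≠ 0 →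
      A.eval (w / z) * z ^ (2 * n) = a.eval (w ^ 2) := by
  refine ⟨∑ i ∈ Finset.range (n + 1), C (a.coeff i) * X ^ (2 * i) * (1 + X ^ 2) ^ (n - i),
    natDegree_sum_le_of_forall_le _ _ fun i hi => ?_, fun w z hwz hz => ?_⟩
  · have h1 : (1 + X ^ 2 : ℝ[X]).natDegree ≤ 2 :=
      (natDegree_add_le _ _).trans (by simp)
    refine natDegree_mul_le.trans (add_le_add (natDegree_C_mul_X_pow_le _ _)
      (natDegree_pow_le_of_le (n - i) h1) |>.trans ?_)
    have := Finset.mem_range.1 hi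
    omega
  · rw [eval_eq_sum_range' (p := a) (n := n + 1) (by omega), eval_finsetSum, Finset.sum_mul]
    refine Finset.sum_congr rfl fun i hi => ?_
    have h1 : 1 + (w / z) ^ 2 = 1 / z ^ 2 := by
      field_simp
      linarith
    simp only [eval_mul, eval_C, eval_pow, eval_X, eval_add, eval_one, h1]
    obtain ⟨k, rfl⟩ : ∃ k, n = i + k := ⟨n - i, by have := Finset.mem_range.1 hi; omega⟩
    rw [Nat.add_sub_cancel_left]
    rw [div_pow, one_div_pow, ← pow_mul, mul_add, pow_add]
    field_simp
    ring

theorem Polynomial.eq_of_eval_sq {p q : ℝ[X]}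
    (h : ∀ w z : ℝ, w ^ 2 + z ^ 2 = 1 → z ≠ 0 → p.eval (w ^ 2) = q.eval (w ^ 2)) : p = q := by
  refine eq_of_infinite_eval_eq p q ((Set.Ioo_infinite (zero_lt_one' ℝ)).mono ?_)
  rintro x ⟨hx0, hx1⟩
  have := h (Real.sqrt x) (Real.sqrt (1 - x))
    (by rw [Real.sq_sqrt hx0.le, Real.sq_sqrt (by linarith)]; ring)
    (Real.sqrt_ne_zero'.2 (by linarith))
  rwa [Real.sq_sqrt hx0.le] at this

theorem IsSumRankOne.exists_even_odd {a b c : ℝ[X]} {m : ℕ}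
    (h : IsSumRankOne {p | p.natDegree ≤ 2 * m} a b c) :
    ∃ a₀ b₀ c₀ a₁ b₁ c₁ : ℝ[X], IsSumRankOne {p | p.natDegree ≤ m} a₀ b₀ c₀ ∧
      IsSumRankOne {p | p.degree < m} a₁ b₁ c₁ ∧ ∀ w z : ℝ, w ^ 2 + z ^ 2 = 1 → z ≠ 0 →
      ((a.eval (w / z) + a.eval (-w / z)) / 2 * z ^ (2 * (2 * m)) =
        (a₀ + X * (1 - X) * a₁).eval (w ^ 2)) ∧
      ((b.eval (w / z) + b.eval (-w / z)) / 2 * z ^ (2 * (2 * m)) =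
        (b₀ + X * (1 - X) * b₁).eval (w ^ 2)) ∧
      ((c.eval (w / z) + c.eval (-w / z)) / 2 * z ^ (2 * (2 * m)) =
        (c₀ + X * (1 - X) * c₁).eval (w ^ 2)) := by
  induction h with
  | zero => exact ⟨0, 0, 0, 0, 0, 0, zero, zero, by simp⟩
  | @add p q a b c hp hq _ ih =>
    obtain ⟨a₀, b₀, c₀, a₁, b₁, c₁, h₀, h₁, H⟩ := ih
    obtain ⟨e, o, he, ho, hpe⟩ := Polynomial.exists_even_odd hp
    obtain ⟨e', o', he', ho', hqe⟩ := Polynomial.exists_even_odd hq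
    refine ⟨_, _, _, _, _, _, h₀.add he he', h₁.add ho ho', fun w z hwz hz => ?_⟩
    obtain ⟨Ha, Hb, Hc⟩ := H w z hwz hz
    have hz2 : z ^ 2 = 1 - w ^ 2 := by linarith
    have p1 := hpe w z hwz hz
    have p2 := hpe (-w) z (by rwa [neg_sq]) hz
    have q1 := hqe w z hwz hz
    have q2 := hqe (-w) z (by rwa [neg_sq]) hz
    rw [neg_sq] at p2 q2
    have hpow : z ^ (2 * (2 * m)) = z ^ (2 * m) * z ^ (2 * m) := by ring
    simp only [eval_add, eval_mul, eval_sub, eval_X, eval_one, hpow] at Ha Hb Hc ⊢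
    generalize z ^ (2 * m) = u at *
    generalize eval (w / z) p = p₁ at *
    generalize eval (-w / z) p = p₂ at *
    generalize eval (w / z) q = q₁ at *
    generalize eval (-w / z) q = q₂ at *
    have aux : ∀ x₁ x₂ y₁ y₂ s t s' t' : ℝ, x₁ = s + w * z * t → x₂ = s + -w * z * t →
        y₁ = s' + w * z * t' → y₂ = s' + -w * z * t' →
        (x₁ * y₁ + x₂ * y₂) / 2 = s * s' + w ^ 2 * (1 - w ^ 2) * (t * t') := by
      rintro _ _ _ _ s t s' t' rfl rfl rfl rfl
      rw [← hz2]
      ring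
    refine ⟨?_, ?_, ?_⟩
    · linear_combination Ha + aux _ _ _ _ _ _ _ _ p1 p2 p1 p2
    · linear_combination Hb + aux _ _ _ _ _ _ _ _ p1 p2 q1 q2
    · linear_combination Hc + aux _ _ _ _ _ _ _ _ q1 q2 q1 q2

/-- A matrix version of the Markov–Lukács theorem for symmetric `2 × 2` matrices. -/
theorem exists_isSumRankOne_of_psd_Icc {a b c : ℝ[X]} {m : ℕ} (ha : a.natDegree ≤ 2 * m)
    (hb : b.natDegree ≤ 2 * m) (hc : c.natDegree ≤ 2 * m)
    (ha0 : ∀ x ∈ Set.Icc (0 : ℝ) 1, 0 ≤ a.eval x) (hc0 : ∀ x ∈ Set.Icc (0 : ℝ) 1, 0 ≤ c.eval x)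
    (hdet : ∀ x ∈ Set.Icc (0 : ℝ) 1, b.eval x ^ 2 ≤ a.eval x * c.eval x) :
    ∃ a₀ b₀ c₀ a₁ b₁ c₁ : ℝ[X], IsSumRankOne {p | p.natDegree ≤ m} a₀ b₀ c₀ ∧
      IsSumRankOne {p | p.degree < m} a₁ b₁ c₁ ∧
      a = a₀ + X * (1 - X) * a₁ ∧ b = b₀ + X * (1 - X) * b₁ ∧ c = c₀ + X * (1 - X) * c₁ := by
  obtain ⟨A, hA, hAe⟩ := Polynomial.exists_homogenize ha
  obtain ⟨B, hB, hBe⟩ := Polynomial.exists_homogenize hb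
  obtain ⟨C', hC, hCe⟩ := Polynomial.exists_homogenize hc
  have hpar : ∀ t : ℝ, ∃ w z : ℝ, w ^ 2 + z ^ 2 = 1 ∧ z ≠ 0 ∧ w / z = t ∧
      w ^ 2 ∈ Set.Icc (0 : ℝ) 1 ∧ 0 < z ^ (2 * (2 * m)) := fun t => by
    have h1 : 0 < 1 + t ^ 2 := by positivity
    have h2 : Real.sqrt (1 + t ^ 2) ≠ 0 := (Real.sqrt_pos.2 h1).ne'
    have h3 : (t / Real.sqrt (1 + t ^ 2)) ^ 2 + (1 / Real.sqrt (1 + t ^ 2)) ^ 2 = 1 := by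
      rw [div_pow, div_pow, Real.sq_sqrt h1.le]
      field_simp
      ring
    refine ⟨t / Real.sqrt (1 + t ^ 2), 1 / Real.sqrt (1 + t ^ 2), h3, by positivity, ?_,
      ⟨sq_nonneg _, ?_⟩, by positivity⟩
    · field_simp
    · linarith [sq_nonneg (1 / Real.sqrt (1 + t ^ 2))]
  have hpsd : IsPSD A B C' := by
    refine ⟨fun t => ?_, fun t => ?_, fun t => ?_⟩ <;>
      obtain ⟨w, z, hwz, hz, rfl, hw, hpos⟩ := hpar t
    · exact nonneg_of_mul_nonneg_left (hAe w z hwz hz ▸ ha0 _ hw) hpos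
    · exact nonneg_of_mul_nonneg_left (hCe w z hwz hz ▸ hc0 _ hw) hpos
    · have := hdet _ hw
      rw [← hAe w z hwz hz, ← hBe w z hwz hz, ← hCe w z hwz hz] at this
      simp only [eval_sub, eval_mul, eval_pow]
      refine nonneg_of_mul_nonneg_left (b := z ^ (2 * (2 * m)) * z ^ (2 * (2 * m))) ?_
        (by positivity)
      linarith
  obtain ⟨a₀, b₀, c₀, a₁, b₁, c₁, h₀, h₁, H⟩ :=
    (hpsd.isSumRankOne.natDegree_le hA hC).exists_even_odd
  have aux : ∀ {p P q : ℝ[X]}, (∀ w z : ℝ, w ^ 2 + z ^ 2 = 1 → z ≠ 0 →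
      P.eval (w / z) * z ^ (2 * (2 * m)) = p.eval (w ^ 2)) →
      (∀ w z : ℝ, w ^ 2 + z ^ 2 = 1 → z ≠ 0 →
        (P.eval (w / z) + P.eval (-w / z)) / 2 * z ^ (2 * (2 * m)) = q.eval (w ^ 2)) →
      p = q := fun {p P q} h h' => eq_of_eval_sq fun w z hwz hz => by
    have h1 := h w z hwz hz
    have h2 := h (-w) z (by rwa [neg_sq]) hz
    rw [neg_sq] at h2
    rw [← h' w z hwz hz]
    linarith
  exact ⟨a₀, b₀, c₀, a₁, b₁, c₁, h₀, h₁, aux hAe fun w z h h' => (H w z h h').1,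
    aux hBe fun w z h h' => (H w z h h').2.1, aux hCe fun w z h h' => (H w z h h').2.2⟩

end PSDMatrix

open MvPolynomial

section Strip

theorem MvPolynomial.totalDegree_aeval_X_le {σ : Type*} (i : σ) (p : Polynomial ℝ) :
    (Polynomial.aeval (X i : MvPolynomial σ ℝ) p).totalDegree ≤ p.natDegree := by
  rw [Polynomial.aeval_eq_sum_range]
  refine totalDegree_finsetSum_le fun k hk => ?_
  refine (totalDegree_smul_le _ _).trans ?_
  rw [totalDegree_X_pow]
  exact Nat.lt_succ_iff.1 (Finset.mem_range.1 hk)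

/-- The bivariate polynomial `a(X) * Y ^ 2 + 2 * b(X) * Y + c(X)`. -/
noncomputable def quadraticInY (a b c : Polynomial ℝ) : MvPolynomial (Fin 2) ℝ :=
  Polynomial.aeval (X 0) a * X 1 ^ 2 + 2 * Polynomial.aeval (X 0) b * X 1 +
    Polynomial.aeval (X 0) c

theorem eval_quadraticInY (a b c : Polynomial ℝ) (x y : ℝ) :
    eval ![x, y] (quadraticInY a b c) = a.eval x * y ^ 2 + 2 * b.eval x * y + c.eval x := by
  have h : ∀ p : Polynomial ℝ,
      eval ![x, y] (Polynomial.aeval (X 0 : MvPolynomial (Fin 2) ℝ) p) = p.eval x := fun p => by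
    induction p using Polynomial.induction_on' with
    | add p q hp hq => simp [hp, hq]
    | monomial n r => simp [Polynomial.aeval_monomial]
  simp [quadraticInY, h]

theorem IsSumRankOne.isSumSq_quadraticInY {S : Set (Polynomial ℝ)} {a b c : Polynomial ℝ}
    {g : MvPolynomial (Fin 2) ℝ} {n : ℕ} (h : IsSumRankOne S a b c)
    (hS : ∀ p ∈ S, ∀ q ∈ S,
      ((Polynomial.aeval (X 0) p * X 1 + Polynomial.aeval (X 0) q) ^ 2 * g).totalDegree ≤ n) :
    IsSumSq (quadraticInY a b c) ∧ (quadraticInY a b c * g).totalDegree ≤ n := by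
  induction h with
  | zero => simp [quadraticInY]
  | @add p q a b c hp hq _ ih =>
    have : quadraticInY (p * p + a) (p * q + b) (q * q + c) =
        (Polynomial.aeval (X 0) p * X 1 + Polynomial.aeval (X 0) q) *
          (Polynomial.aeval (X 0) p * X 1 + Polynomial.aeval (X 0) q) + quadraticInY a b c := by
      simp only [quadraticInY, map_add, map_mul]
      ring
    rw [this]
    refine ⟨(IsSumSq.mul_self _).add ih.1, ?_⟩
    rw [add_mul, ← sq]
    exact (totalDegree_add _ _).trans (max_le (hS p hp q hq) ih.2)

theorem totalDegree_sq_linearInY_le {p q : Polynomial ℝ} {n : ℕ} (hp : p.natDegree ≤ n)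
    (hq : q.natDegree ≤ n) :
    ((Polynomial.aeval (X 0 : MvPolynomial (Fin 2) ℝ) p * X 1 +
      Polynomial.aeval (X 0) q) ^ 2).totalDegree ≤ 2 * n + 2 := by
  have h1 := totalDegree_aeval_X_le (0 : Fin 2) p
  have h2 := totalDegree_aeval_X_le (0 : Fin 2) q
  have h3 := totalDegree_mul (Polynomial.aeval (X 0 : MvPolynomial (Fin 2) ℝ) p) (X 1)
  rw [totalDegree_X] at h3
  have h4 := totalDegree_add (Polynomial.aeval (X 0 : MvPolynomial (Fin 2) ℝ) p * X 1)
    (Polynomial.aeval (X 0) q)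
  have h5 := totalDegree_pow (Polynomial.aeval (X 0 : MvPolynomial (Fin 2) ℝ) p * X 1 +
      Polynomial.aeval (X 0) q) 2
  omega

theorem totalDegree_X_mul_one_sub_X_le :
    (X 0 * (1 - X 0) : MvPolynomial (Fin 2) ℝ).totalDegree ≤ 2 := by
  have h1 := totalDegree_mul (X 0 : MvPolynomial (Fin 2) ℝ) (1 - X 0)
  have h2 := totalDegree_sub (1 : MvPolynomial (Fin 2) ℝ) (X 0)
  rw [totalDegree_X] at h1 h2
  rw [totalDegree_one] at h2
  omega

theorem exists_eq_quadraticInY (f : MvPolynomial (Fin 2) ℝ) (hf : degreeOf 1 f ≤ 2) :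
    ∃ a b c : Polynomial ℝ, a.natDegree ≤ degreeOf 0 f ∧ b.natDegree ≤ degreeOf 0 f ∧
      c.natDegree ≤ degreeOf 0 f ∧ f = quadraticInY a b c := by
  set P : ℕ → Polynomial ℝ := fun j =>
    ∑ s ∈ f.support with s 1 = j, Polynomial.monomial (s 0) (coeff s f) with hP
  have hdeg : ∀ j, (P j).natDegree ≤ degreeOf 0 f := fun j =>
    Polynomial.natDegree_sum_le_of_forall_le _ _ fun s hs =>
      (Polynomial.natDegree_monomial_le _).trans
        (monomial_le_degreeOf 0 (Finset.mem_filter.1 hs).1)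
  have hsum : f = ∑ j ∈ Finset.range 3, Polynomial.aeval (X 0) (P j) * X 1 ^ j := by
    conv_lhs => rw [f.as_sum]
    rw [← Finset.sum_fiberwise_of_maps_to (t := Finset.range 3) (g := fun s => s 1)
      (fun s hs => Finset.mem_range.2 (Nat.lt_succ_iff.2 ((monomial_le_degreeOf 1 hs).trans hf)))]
    refine Finset.sum_congr rfl fun j _ => ?_
    rw [hP, map_sum, Finset.sum_mul]
    refine Finset.sum_congr rfl fun s hs => ?_
    rw [Polynomial.aeval_monomial, monomial_eq, Finsupp.prod_fintype _ _ (by simp),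
      Fin.prod_univ_two, (Finset.mem_filter.1 hs).2, algebraMap_eq, mul_assoc]
  refine ⟨P 2, Polynomial.C (1 / 2) * P 1, P 0, hdeg 2,
    (Polynomial.natDegree_C_mul_le _ _).trans (hdeg 1), hdeg 0, ?_⟩
  have h2 : (2 : MvPolynomial (Fin 2) ℝ) * C (1 / 2) = 1 := by
    rw [← map_ofNat C 2, ← C_mul]
    norm_num
  conv_lhs => rw [hsum]
  simp only [Finset.sum_range_succ, Finset.sum_range_zero, quadraticInY, map_mul,
    Polynomial.aeval_C, algebraMap_eq]
  linear_combination -(Polynomial.aeval (X 0) (P 1) * X 1) * h2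

theorem nonneg_of_forall_quadratic_nonneg {a b c : ℝ}
    (h : ∀ y : ℝ, 0 ≤ a * y ^ 2 + 2 * b * y + c) : 0 ≤ a ∧ 0 ≤ c ∧ b ^ 2 ≤ a * c := by
  have hc : 0 ≤ c := by simpa using h 0
  have hd := discrim_le_zero (a := a) (b := 2 * b) (c := c) fun y => by
    linarith [h y, sq y]
  rw [discrim] at hd
  refine ⟨?_, hc, by linarith⟩
  by_contra! ha
  have h1 := h (1 + c / -a)
  have h2 := h (-(1 + c / -a))
  have h3 : a * (1 + c / -a) = a - c := by
    have := ha.ne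
    field_simp
    ring
  have h4 : 0 ≤ c / -a := div_nonneg hc (by linarith)
  nlinarith

end Strip

theorem stmt_0 (f : MvPolynomial (Fin 2) ℝ)
    (hf : ∀ x y : ℝ, x ∈ Set.Icc (0:ℝ) 1 → 0 ≤ eval ![x, y] f)
    (hdegY : degreeOf 1 f ≤ 2) :
    ∃ σ₀ σ₁ : MvPolynomial (Fin 2) ℝ, IsSumSq σ₀ ∧ IsSumSq σ₁ ∧
      f = σ₀ + σ₁ * (X 0 * (1 - X 0)) ∧
      σ₀.totalDegree ≤ degreeOf 0 f + 3 ∧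
      (σ₁ * (X 0 * (1 - X 0))).totalDegree ≤ degreeOf 0 f + 3 := by
  obtain ⟨a, b, c, ha, hb, hc, rfl⟩ := exists_eq_quadraticInY f hdegY
  set d := degreeOf 0 (quadraticInY a b c)
  obtain ⟨m, hdm, hmd⟩ : ∃ m, d ≤ 2 * m ∧ 2 * m ≤ d + 1 := ⟨(d + 1) / 2, by omega, by omega⟩
  have key : ∀ x ∈ Set.Icc (0 : ℝ) 1,
      0 ≤ a.eval x ∧ 0 ≤ c.eval x ∧ b.eval x ^ 2 ≤ a.eval x * c.eval x := fun x hx =>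
    nonneg_of_forall_quadratic_nonneg fun y => eval_quadraticInY a b c x y ▸ hf x y hx
  obtain ⟨a₀, b₀, c₀, a₁, b₁, c₁, h₀, h₁, rfl, rfl, rfl⟩ := exists_isSumRankOne_of_psd_Icc
    (ha.trans hdm) (hb.trans hdm) (hc.trans hdm) (fun x hx => (key x hx).1)
    (fun x hx => (key x hx).2.1) (fun x hx => (key x hx).2.2)
  have H₀ := h₀.isSumSq_quadraticInY (g := 1) (n := d + 3) fun p hp q hq => by
    rw [mul_one]
    exact (totalDegree_sq_linearInY_le hp hq).trans (by omega)
  have H₁ := h₁.isSumSq_quadraticInY (g := X 0 * (1 - X 0)) (n := d + 3) fun p hp q hq => by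
    rcases Nat.eq_zero_or_pos m with rfl | hm
    · have hp0 : p = 0 := by simpa using hp
      have hq0 : q = 0 := by simpa using hq
      simp [hp0, hq0]
    · have hlt : ∀ r : Polynomial ℝ, r.degree < m → r.natDegree ≤ m - 1 := fun r hr => by
        rcases eq_or_ne r 0 with rfl | hr0
        · simp
        · exact Nat.le_sub_one_of_lt ((Polynomial.natDegree_lt_iff_degree_lt hr0).2 hr)
      have h1 := totalDegree_sq_linearInY_le (hlt p hp) (hlt q hq)
      have h2 := totalDegree_X_mul_one_sub_X_le
      exact (totalDegree_mul _ _).trans (by omega)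
  refine ⟨_, _, H₀.1, H₁.1, ?_, by simpa using H₀.2, H₁.2⟩
  simp only [quadraticInY, map_add, map_mul, map_sub, map_one, Polynomial.aeval_X]
  ring
end

section
/- Let d, e ∈ ℕ₀ and let f̄ be a generator of an extreme ray of the cone C_{d,e}. Then f̄ vanishes at some point of S, i.e., there exists (x,y,z) ∈ S with f̄(x,y,z) = 0. -/
noncomputable def toMv (p : Polynomial ℝ) : MvPolynomial (Fin 3) ℝ :=
  Polynomial.aeval (MvPolynomial.X 0) p

def inS (x y z : ℝ) : Prop := x ∈ Set.Icc (0:ℝ) 1 ∧ (y, z) ≠ (0, 0)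

noncomputable def quadForm (f₂ f₁ f₀ : Polynomial ℝ) : MvPolynomial (Fin 3) ℝ :=
  toMv f₂ * MvPolynomial.X 1 ^ 2 + toMv f₁ * MvPolynomial.X 1 * MvPolynomial.X 2
    + toMv f₀ * MvPolynomial.X 2 ^ 2

def coneC (d e : ℕ) : Set (MvPolynomial (Fin 3) ℝ) :=
  {f | (∃ f₂ f₁ f₀ : Polynomial ℝ, f = quadForm f₂ f₁ f₀ ∧
          f₂.natDegree ≤ d ∧ f₁.natDegree ≤ (d + e) / 2 ∧ f₀.natDegree ≤ e) ∧
       ∀ x y z : ℝ, inS x y z → 0 ≤ MvPolynomial.eval ![x, y, z] f}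

def genExtremeRay (d e : ℕ) (f : MvPolynomial (Fin 3) ℝ) : Prop :=
  f ≠ 0 ∧ f ∈ coneC d e ∧
    ∀ g h : MvPolynomial (Fin 3) ℝ, g ∈ coneC d e → h ∈ coneC d e → g + h = f →
      (∃ c : ℝ, 0 ≤ c ∧ g = c • f) ∧ ∃ c : ℝ, 0 ≤ c ∧ h = c • f

theorem eval_quadForm (f₂ f₁ f₀ : Polynomial ℝ) (x y z : ℝ) :
    MvPolynomial.eval ![x, y, z] (quadForm f₂ f₁ f₀) =
      f₂.eval x * y ^ 2 + f₁.eval x * y * z + f₀.eval x * z ^ 2 := by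
  have eval_toMv (p : Polynomial ℝ) : MvPolynomial.eval ![x, y, z] (toMv p) = p.eval x := by
    rw [toMv, ← MvPolynomial.coe_aeval_eq_eval, RingHom.coe_coe, ← Polynomial.aeval_algHom_apply]
    simp
  simp [quadForm, eval_toMv]

theorem quadForm_add (f₂ f₁ f₀ g₂ g₁ g₀ : Polynomial ℝ) :
    quadForm f₂ f₁ f₀ + quadForm g₂ g₁ g₀ = quadForm (f₂ + g₂) (f₁ + g₁) (f₀ + g₀) := by
  simp only [quadForm, toMv, map_add]
  ring

/-- A quadratic form in `(y, z)` with continuous coefficients that is positive definite over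
`[0, 1]` stays nonnegative after subtracting a small positive multiple of `y ^ 2`. -/
theorem exists_pos_mul_sq_le {a b c : ℝ → ℝ} (ha : Continuous a) (hb : Continuous b)
    (hc : Continuous c)
    (h : ∀ x y z, inS x y z → 0 < a x * y ^ 2 + b x * y * z + c x * z ^ 2) :
    ∃ ε > 0, ∀ x ∈ Set.Icc (0 : ℝ) 1, ∀ y z : ℝ,
      ε * y ^ 2 ≤ a x * y ^ 2 + b x * y * z + c x * z ^ 2 := by
  have hc_pos : ∀ x ∈ Set.Icc (0 : ℝ) 1, 0 < c x := fun x hx => by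
    simpa using h x 0 1 ⟨hx, by simp⟩
  have hdisc : ∀ x ∈ Set.Icc (0 : ℝ) 1, 0 < 4 * a x * c x - b x ^ 2 := fun x hx => by
    have hcx := hc_pos x hx
    have hpos := h x (2 * c x) (-b x) ⟨hx, by simp [hcx.ne']⟩
    exact pos_of_mul_pos_right (by linear_combination hpos) hcx.le
  obtain ⟨x₀, hx₀, hmin⟩ := isCompact_Icc.exists_isMinOn (Set.nonempty_Icc.2 zero_le_one)
    (f := fun x => (4 * a x * c x - b x ^ 2) / (4 * c x))
    (ContinuousOn.div (by fun_prop) (by fun_prop)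
      fun x hx => (mul_pos four_pos (hc_pos x hx)).ne')
  refine ⟨_, div_pos (hdisc x₀ hx₀) (mul_pos four_pos (hc_pos x₀ hx₀)), fun x hx y z => ?_⟩
  have hcx : 0 < 4 * c x := mul_pos four_pos (hc_pos x hx)
  have hle := isMinOn_iff.1 hmin x hx
  refine (mul_le_mul_of_nonneg_right hle (sq_nonneg y)).trans ?_
  rw [div_mul_eq_mul_div, div_le_iff₀ hcx]
  linear_combination sq_nonneg (b x * y + 2 * c x * z)

theorem stmt_4 (d e : ℕ) (f : MvPolynomial (Fin 3) ℝ)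
    (hf : genExtremeRay d e f) :
    ∃ x y z : ℝ, inS x y z ∧ MvPolynomial.eval ![x, y, z] f = 0 := by
  obtain ⟨-, ⟨⟨f₂, f₁, f₀, rfl, h₂, h₁, h₀⟩, hnn⟩, hext⟩ := hf
  by_contra! hne
  obtain ⟨ε, hε, hle⟩ := exists_pos_mul_sq_le f₂.continuous f₁.continuous f₀.continuous
    fun x y z hS => by
      rw [← eval_quadForm]
      exact (hnn x y z hS).lt_of_ne (hne x y z hS).symm
  have hg : quadForm (Polynomial.C ε) 0 0 ∈ coneC d e :=
    ⟨⟨_, _, _, rfl, by simp, by simp, by simp⟩, fun x y z _ => by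
      simp only [eval_quadForm, Polynomial.eval_C, Polynomial.eval_zero]
      ring_nf
      positivity⟩
  have hh : quadForm (f₂ - Polynomial.C ε) f₁ f₀ ∈ coneC d e :=
    ⟨⟨_, _, _, rfl, by simpa using h₂, h₁, h₀⟩, fun x y z hS => by
      simp only [eval_quadForm, Polynomial.eval_sub, Polynomial.eval_C]
      linear_combination hle x hS.1 y z⟩
  obtain ⟨⟨k, -, hk⟩, -⟩ := hext _ _ hg hh (by simp [quadForm_add])
  have hk₁ := congrArg (MvPolynomial.eval ![0, 1, 0]) hk
  have hk₀ := congrArg (MvPolynomial.eval ![0, 0, 1]) hk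
  rw [MvPolynomial.smul_eval] at hk₀ hk₁
  have hk_zero : k = 0 :=
    (mul_eq_zero.1 (hk₀.symm.trans (by simp [eval_quadForm]))).resolve_right
      (hne 0 0 1 ⟨by simp, by simp⟩)
  rw [hk_zero, zero_mul, eval_quadForm] at hk₁
  exact hε.ne' (by simpa using hk₁)
end

section
/- Let d, e ∈ ℕ₀ and let f̄ = f₂(X)Y² + f₁(X)YZ + f₀(X)Z² be a generator of an extreme ray of the cone C_{d,e}. If f₂ = 0, f₁ = 0 or f₀ = 0, then f̄ is of the form r(X)Y² or r(X)Z² for some r ∈ ℝ[X]. -/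
theorem eval_toMv (p : Polynomial ℝ) (v : Fin 3 → ℝ) :
    MvPolynomial.eval v (toMv p) = p.eval (v 0) := by
  rw [toMv, ← MvPolynomial.coe_aeval_eq_eval, RingHom.coe_coe, ← Polynomial.aeval_algHom_apply]
  simp

theorem quadForm_injective {f₂ f₁ f₀ g₂ g₁ g₀ : Polynomial ℝ}
    (h : quadForm f₂ f₁ f₀ = quadForm g₂ g₁ g₀) : f₂ = g₂ ∧ f₁ = g₁ ∧ f₀ = g₀ := by
  have key (x y z : ℝ) := congrArg (MvPolynomial.eval ![x, y, z]) h
  simp only [eval_quadForm] at key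
  refine ⟨Polynomial.funext fun x => ?_, Polynomial.funext fun x => ?_,
    Polynomial.funext fun x => ?_⟩
  · simpa using key x 1 0
  · linarith [key x 1 0, key x 0 1, key x 1 1]
  · simpa using key x 0 1

theorem quadForm_mem_coneC_iff {d e : ℕ} {f₂ f₁ f₀ : Polynomial ℝ} :
    quadForm f₂ f₁ f₀ ∈ coneC d e ↔
      (f₂.natDegree ≤ d ∧ f₁.natDegree ≤ (d + e) / 2 ∧ f₀.natDegree ≤ e) ∧
        ∀ x ∈ Set.Icc (0 : ℝ) 1, ∀ y z : ℝ,
          0 ≤ f₂.eval x * y ^ 2 + f₁.eval x * y * z + f₀.eval x * z ^ 2 := by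
  constructor
  · rintro ⟨⟨g₂, g₁, g₀, h, hdeg⟩, hpos⟩
    obtain ⟨rfl, rfl, rfl⟩ := quadForm_injective h
    refine ⟨hdeg, fun x hx y z => ?_⟩
    by_cases hyz : (y, z) = (0, 0)
    · obtain ⟨rfl, rfl⟩ := Prod.mk.inj hyz
      simp
    · simpa only [eval_quadForm] using hpos x y z ⟨hx, hyz⟩
  · rintro ⟨hdeg, hpos⟩
    refine ⟨⟨f₂, f₁, f₀, rfl, hdeg⟩, fun x y z h => ?_⟩
    rw [eval_quadForm]
    exact hpos x h.1 y z

/-- An affine function that is nonnegative on the whole line is constant. -/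
theorem eq_zero_of_forall_mul_add_nonneg {a b : ℝ} (h : ∀ t : ℝ, 0 ≤ a * t + b) : a = 0 := by
  by_contra ha
  have h' := h (-(b + 1) / a)
  rw [mul_div_cancel₀ _ ha] at h'
  linarith

theorem eq_zero_of_eval_eq_zero_on_Icc {p : Polynomial ℝ}
    (h : ∀ x ∈ Set.Icc (0 : ℝ) 1, p.eval x = 0) : p = 0 :=
  Polynomial.eq_zero_of_infinite_isRoot p ((Set.Icc_infinite one_pos).mono h)

theorem toMv_zero : toMv 0 = 0 := map_zero _

theorem stmt_5 (d e : ℕ) (f₂ f₁ f₀ : Polynomial ℝ)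
    (hf : genExtremeRay d e (quadForm f₂ f₁ f₀))
    (hzero : f₂ = 0 ∨ f₁ = 0 ∨ f₀ = 0) :
    ∃ r : Polynomial ℝ,
      quadForm f₂ f₁ f₀ = toMv r * MvPolynomial.X 1 ^ 2 ∨
      quadForm f₂ f₁ f₀ = toMv r * MvPolynomial.X 2 ^ 2 := by
  obtain ⟨-, hmem, hext⟩ := hf
  obtain ⟨⟨hd₂, -, hd₀⟩, hpos⟩ := quadForm_mem_coneC_iff.1 hmem
  rcases hzero with rfl | rfl | rfl
  · have h₁ : f₁ = 0 := eq_zero_of_eval_eq_zero_on_Icc fun x hx =>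
      eq_zero_of_forall_mul_add_nonneg (b := f₀.eval x) fun t => by simpa using hpos x hx t 1
    exact ⟨f₀, Or.inr (by simp [quadForm, h₁, toMv_zero])⟩
  · have hg : quadForm f₂ 0 0 ∈ coneC d e := quadForm_mem_coneC_iff.2
      ⟨by simpa using hd₂, fun x hx y z => by simpa using hpos x hx y 0⟩
    have hh : quadForm 0 0 f₀ ∈ coneC d e := quadForm_mem_coneC_iff.2
      ⟨by simpa using hd₀, fun x hx y z => by simpa using hpos x hx 0 z⟩
    have hsum : quadForm f₂ 0 0 + quadForm 0 0 f₀ = quadForm f₂ 0 f₀ := by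
      simp [quadForm, toMv_zero]
    obtain ⟨⟨c, -, hc⟩, -⟩ := hext _ _ hg hh hsum
    rcases eq_or_ne c 0 with rfl | hc0
    · refine ⟨f₀, Or.inr ?_⟩
      rw [← hsum, hc]
      simp [quadForm, toMv_zero]
    · refine ⟨c⁻¹ • f₂, Or.inl ?_⟩
      rw [← inv_smul_smul₀ hc0 (quadForm f₂ 0 f₀), ← hc]
      simp [quadForm, toMv]
  · have h₁ : f₁ = 0 := eq_zero_of_eval_eq_zero_on_Icc fun x hx =>
      eq_zero_of_forall_mul_add_nonneg (b := f₂.eval x) fun t => by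
        simpa [add_comm] using hpos x hx 1 t
    exact ⟨f₂, Or.inl (by simp [quadForm, h₁, toMv_zero])⟩
end

section
/- Let f ∈ ℝ[X,Y] with f ≥ 0 on the strip [0,1]×ℝ, deg_X f = 1 and m = deg_Y f. Then f(X,Y) = f(1,Y)·X + f(0,Y)·(1−X), and there exist sums of squares σ₀, σ₁ in ℝ[X,Y] such that f = σ₀ + σ₁·X(1−X) with deg(σ₀) ≤ m + 2 and deg(σ₁·X(1−X)) ≤ m + 2; in fact one may take σ₀ = f(1,Y)X² + f(0,Y)(1−X)² and σ₁ = f(1,Y) + f(0,Y). -/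
open MvPolynomial

theorem IsSumSq.map {R S : Type*} [Semiring R] [Semiring S] (φ : R →+* S) {a : R}
    (ha : IsSumSq a) : IsSumSq (φ a) := by
  induction ha with
  | zero => simp
  | sq_add b _ ih =>
    rw [map_add, map_mul]
    exact (IsSumSq.mul_self _).add ih

theorem Polynomial.isSumSq_of_forall_eval_nonneg (p : Polynomial ℝ) (hp : ∀ y, 0 ≤ p.eval y) :
    IsSumSq p := by
  induction hn : p.natDegree using Nat.strong_induction_on generalizing p with
  | _ n ih =>
  subst hn
  have isSumSq_C (a : ℝ) (ha : 0 ≤ a) : IsSumSq (Polynomial.C a) := by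
    rw [← Real.mul_self_sqrt ha, Polynomial.C_mul]
    exact IsSumSq.mul_self _
  by_cases hd : p.natDegree = 0
  · rw [Polynomial.eq_C_of_natDegree_eq_zero hd] at hp ⊢
    exact isSumSq_C _ (by simpa using hp 0)
  obtain ⟨c, hc⟩ : ∃ c, ∀ y, p.eval c ≤ p.eval y := by
    refine p.continuous.exists_forall_le ?_
    have h := p.tendsto_norm_atTop (Polynomial.natDegree_pos_iff_degree_pos.mp (by omega))
      (tendsto_norm_cocompact_atTop (E := ℝ))
    simpa only [Real.norm_of_nonneg (hp _)] using h
  have hderiv : p.derivative.eval c = 0 := by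
    rw [← Polynomial.deriv]
    exact IsLocalMin.deriv_eq_zero (Filter.Eventually.of_forall hc)
  obtain ⟨r, hr⟩ : Polynomial.X - Polynomial.C c ∣ p - Polynomial.C (p.eval c) :=
    Polynomial.dvd_iff_isRoot.mpr (by simp)
  obtain ⟨q, rfl⟩ : Polynomial.X - Polynomial.C c ∣ r := by
    refine Polynomial.dvd_iff_isRoot.mpr ?_
    have h := congrArg (fun s => s.derivative.eval c) hr
    simpa [Polynomial.derivative_mul, hderiv, eq_comm] using h
  have hpq : p = Polynomial.C (p.eval c) +
      (Polynomial.X - Polynomial.C c) * (Polynomial.X - Polynomial.C c) * q := by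
    linear_combination hr
  have hq0 : q ≠ 0 := by
    rintro rfl
    rw [hpq] at hd
    simp at hd
  have hdeg : q.natDegree < p.natDegree := by
    have h := congrArg Polynomial.natDegree hr
    rw [Polynomial.natDegree_sub_C, Polynomial.natDegree_mul (Polynomial.X_sub_C_ne_zero c)
      (mul_ne_zero (Polynomial.X_sub_C_ne_zero c) hq0),
      Polynomial.natDegree_mul (Polynomial.X_sub_C_ne_zero c) hq0,
      Polynomial.natDegree_X_sub_C] at h
    omega
  have hq_off (y : ℝ) (hy : y ∈ ({c}ᶜ : Set ℝ)) : 0 ≤ q.eval y := by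
    have h := congrArg (Polynomial.eval y) hr
    simp only [Polynomial.eval_sub, Polynomial.eval_mul, Polynomial.eval_X,
      Polynomial.eval_C] at h
    have hpos : 0 < (y - c) * (y - c) := mul_self_pos.mpr (sub_ne_zero.mpr hy)
    refine nonneg_of_mul_nonneg_right (a := (y - c) * (y - c)) ?_ hpos
    linarith [hc y]
  have hq (y : ℝ) : 0 ≤ q.eval y := by
    have hcl : IsClosed {y | 0 ≤ q.eval y} := isClosed_le continuous_const q.continuous
    exact hcl.closure_subset_iff.mpr hq_off (dense_compl_singleton c y)
  rw [hpq]
  exact (isSumSq_C _ (hp c)).add ((IsSumSq.mul_self _).mul (ih _ hdeg q hq rfl))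

namespace MvPolynomial

theorem isSumSq_aeval_C_X_one (f : MvPolynomial (Fin 2) ℝ) (c : ℝ)
    (hf : ∀ y, 0 ≤ eval ![c, y] f) :
    IsSumSq (aeval (![C c, X 1] : Fin 2 → MvPolynomial (Fin 2) ℝ) f) := by
  set p : Polynomial ℝ := aeval ![Polynomial.C c, Polynomial.X] f with hp
  have hfp : aeval (![C c, X 1] : Fin 2 → MvPolynomial (Fin 2) ℝ) f
      = Polynomial.aeval (X 1 : MvPolynomial (Fin 2) ℝ) p := by
    rw [hp, comp_aeval_apply]
    congr 2
    funext i
    fin_cases i <;> simp [algebraMap_eq]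
  have hpe (y : ℝ) : p.eval y = eval ![c, y] f := by
    rw [← Polynomial.coe_aeval_eq_eval, hp, comp_aeval_apply, ← coe_aeval_eq_eval]
    simp only [RingHom.coe_coe]
    congr 2
    funext i
    fin_cases i <;> simp
  rw [hfp]
  exact IsSumSq.map (Polynomial.aeval (X 1)).toRingHom
    (p.isSumSq_of_forall_eval_nonneg fun y => hpe y ▸ hf y)

theorem totalDegree_aeval_C_X_one_le (f : MvPolynomial (Fin 2) ℝ) (c : ℝ) :
    (aeval (![C c, X 1] : Fin 2 → MvPolynomial (Fin 2) ℝ) f).totalDegree ≤ degreeOf 1 f := by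
  rw [aeval_def, eval₂_eq']
  refine totalDegree_finsetSum_le fun s hs => ?_
  rw [Fin.prod_univ_two]
  simp only [Matrix.cons_val_zero, Matrix.cons_val_one, algebraMap_eq, ← C_pow, ← mul_assoc,
    ← map_mul]
  refine (totalDegree_mul _ _).trans ?_
  rw [totalDegree_C, zero_add]
  simpa using monomial_le_degreeOf 1 hs

theorem eq_aeval_mul_X_add_aeval_mul_one_sub_X (f : MvPolynomial (Fin 2) ℝ)
    (hf : degreeOf 0 f ≤ 1) :
    f = aeval (![1, X 1] : Fin 2 → MvPolynomial (Fin 2) ℝ) f * X 0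
        + aeval (![0, X 1] : Fin 2 → MvPolynomial (Fin 2) ℝ) f * (1 - X 0) := by
  have hX : f = aeval (X : Fin 2 → MvPolynomial (Fin 2) ℝ) f := by simp
  conv_lhs => rw [hX]
  simp only [aeval_def, eval₂_eq', Finset.sum_mul, ← Finset.sum_add_distrib]
  refine Finset.sum_congr rfl fun s hs => ?_
  have hs1 : s 0 ≤ 1 := (monomial_le_degreeOf 0 hs).trans hf
  simp only [Fin.prod_univ_two, Matrix.cons_val_zero, Matrix.cons_val_one]
  interval_cases s 0 <;> ring

end MvPolynomial

theorem stmt_16 (f : MvPolynomial (Fin 2) ℝ) (m : ℕ)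
    (hf : ∀ x y : ℝ, x ∈ Set.Icc (0:ℝ) 1 → 0 ≤ eval ![x, y] f)
    (hdX : degreeOf 0 f = 1) (hm : m = degreeOf 1 f) :
    f = (aeval (![1, X 1] : Fin 2 → MvPolynomial (Fin 2) ℝ) f) * X 0
        + (aeval (![0, X 1] : Fin 2 → MvPolynomial (Fin 2) ℝ) f) * (1 - X 0) ∧
    IsSumSq ((aeval (![1, X 1] : Fin 2 → MvPolynomial (Fin 2) ℝ) f) * (X 0) ^ 2
        + (aeval (![0, X 1] : Fin 2 → MvPolynomial (Fin 2) ℝ) f) * (1 - X 0) ^ 2) ∧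
    IsSumSq (aeval (![1, X 1] : Fin 2 → MvPolynomial (Fin 2) ℝ) f
        + aeval (![0, X 1] : Fin 2 → MvPolynomial (Fin 2) ℝ) f) ∧
    f = ((aeval (![1, X 1] : Fin 2 → MvPolynomial (Fin 2) ℝ) f) * (X 0) ^ 2
        + (aeval (![0, X 1] : Fin 2 → MvPolynomial (Fin 2) ℝ) f) * (1 - X 0) ^ 2)
        + (aeval (![1, X 1] : Fin 2 → MvPolynomial (Fin 2) ℝ) f
            + aeval (![0, X 1] : Fin 2 → MvPolynomial (Fin 2) ℝ) f) * (X 0 * (1 - X 0)) ∧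
    ((aeval (![1, X 1] : Fin 2 → MvPolynomial (Fin 2) ℝ) f) * (X 0) ^ 2
        + (aeval (![0, X 1] : Fin 2 → MvPolynomial (Fin 2) ℝ) f) * (1 - X 0) ^ 2).totalDegree
      ≤ m + 2 ∧
    ((aeval (![1, X 1] : Fin 2 → MvPolynomial (Fin 2) ℝ) f
        + aeval (![0, X 1] : Fin 2 → MvPolynomial (Fin 2) ℝ) f)
          * (X 0 * (1 - X 0))).totalDegree ≤ m + 2 := by
  have hA := isSumSq_aeval_C_X_one f 1 fun y => hf 1 y (by simp)
  have hB := isSumSq_aeval_C_X_one f 0 fun y => hf 0 y (by simp)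
  have dA := totalDegree_aeval_C_X_one_le f 1
  have dB := totalDegree_aeval_C_X_one_le f 0
  have hfAB := eq_aeval_mul_X_add_aeval_mul_one_sub_X f hdX.le
  rw [← hm] at dA dB
  rw [C_1] at hA dA
  rw [C_0] at hB dB
  set A := aeval (![1, X 1] : Fin 2 → MvPolynomial (Fin 2) ℝ) f
  set B := aeval (![0, X 1] : Fin 2 → MvPolynomial (Fin 2) ℝ) f
  have dX : (X 0 : MvPolynomial (Fin 2) ℝ).totalDegree ≤ 1 := (totalDegree_X _).le
  have dX' : (1 - X 0 : MvPolynomial (Fin 2) ℝ).totalDegree ≤ 1 :=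
    (totalDegree_sub _ _).trans (by simp)
  refine ⟨hfAB, ?_, hA.add hB, by linear_combination hfAB, ?_, ?_⟩
  · rw [sq, sq]
    exact (hA.mul (IsSumSq.mul_self _)).add (hB.mul (IsSumSq.mul_self _))
  · refine (totalDegree_add _ _).trans (max_le ?_ ?_)
    · exact (totalDegree_mul _ _).trans
        (add_le_add dA ((totalDegree_pow _ _).trans (Nat.mul_le_mul_left 2 dX)))
    · exact (totalDegree_mul _ _).trans
        (add_le_add dB ((totalDegree_pow _ _).trans (Nat.mul_le_mul_left 2 dX')))
  · refine (totalDegree_mul _ _).trans (add_le_add ?_ ?_)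
    · exact (totalDegree_add _ _).trans (max_le dA dB)
    · exact (totalDegree_mul _ _).trans (add_le_add dX dX')
end

section
/- Let f̄ = f₂(X)Y² + f₁(X)YZ + f₀(X)Z² ∈ ℝ[X,Y,Z] with f̄ ≥ 0 on S, and let x₀ ∈ [0,1]. Then f₂(x₀) ≥ 0 and f₀(x₀) ≥ 0; if (X − x₀) divides f₂ or (X − x₀) divides f₀, then (X − x₀) divides f₁; moreover, if x₀ ∈ (0,1) and (X − x₀) divides f₂, then (X − x₀)² divides f₂, and similarly, if x₀ ∈ (0,1) and (X − x₀) divides f₀, then (X − x₀)² divides f₀. -/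
/-- If `b * y + c` is nonnegative for all real `y`, then `b = 0`. -/
lemma linear_coeff_eq_zero_of_nonneg {b c : ℝ} (h : ∀ y : ℝ, 0 ≤ b * y + c) : b = 0 := by
  by_contra hb
  have h1 := h (-(c + 1) / b)
  rw [mul_div_cancel₀ _ hb] at h1
  linarith

/-- An interior root of a real polynomial that is nonnegative on a set is at least double. -/
lemma Polynomial.sq_X_sub_C_dvd_of_nonneg_on {p : Polynomial ℝ} {s : Set ℝ} {a : ℝ}
    (hs : s ∈ nhds a) (hp : ∀ x ∈ s, 0 ≤ p.eval x) (ha : X - C a ∣ p) :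
    (X - C a) ^ 2 ∣ p := by
  have hroot : p.eval a = 0 := dvd_iff_isRoot.mp ha
  have hmin : IsLocalMin (fun x => p.eval x) a := by
    filter_upwards [hs] with x hx
    simpa only [hroot] using hp x hx
  have hderiv := hmin.hasDerivAt_eq_zero (p.hasDerivAt a)
  obtain ⟨q, rfl⟩ := ha
  have hq : q.IsRoot a := by simpa using hderiv
  rw [pow_two]
  exact mul_dvd_mul_left _ (dvd_iff_isRoot.mpr hq)

theorem stmt_17 (f₂ f₁ f₀ : Polynomial ℝ)
    (hf : ∀ x y z : ℝ, x ∈ Set.Icc (0:ℝ) 1 → (y, z) ≠ (0, 0) →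
      0 ≤ f₂.eval x * y ^ 2 + f₁.eval x * (y * z) + f₀.eval x * z ^ 2)
    (x₀ : ℝ) (hx₀ : x₀ ∈ Set.Icc (0:ℝ) 1) :
    0 ≤ f₂.eval x₀ ∧ 0 ≤ f₀.eval x₀ ∧
    ((Polynomial.X - Polynomial.C x₀ ∣ f₂ ∨ Polynomial.X - Polynomial.C x₀ ∣ f₀) →
      Polynomial.X - Polynomial.C x₀ ∣ f₁) ∧
    (x₀ ∈ Set.Ioo (0:ℝ) 1 → Polynomial.X - Polynomial.C x₀ ∣ f₂ →
      (Polynomial.X - Polynomial.C x₀) ^ 2 ∣ f₂) ∧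
    (x₀ ∈ Set.Ioo (0:ℝ) 1 → Polynomial.X - Polynomial.C x₀ ∣ f₀ →
      (Polynomial.X - Polynomial.C x₀) ^ 2 ∣ f₀) := by
  have h₂ : ∀ x ∈ Set.Icc (0:ℝ) 1, 0 ≤ f₂.eval x := fun x hx => by
    simpa using hf x 1 0 hx (by simp)
  have h₀ : ∀ x ∈ Set.Icc (0:ℝ) 1, 0 ≤ f₀.eval x := fun x hx => by
    simpa using hf x 0 1 hx (by simp)
  refine ⟨h₂ x₀ hx₀, h₀ x₀ hx₀, ?_, ?_, ?_⟩
  · simp only [Polynomial.dvd_iff_isRoot, Polynomial.IsRoot.def]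
    rintro (h | h)
    · refine linear_coeff_eq_zero_of_nonneg (c := f₀.eval x₀) fun y => ?_
      simpa [h] using hf x₀ y 1 hx₀ (by simp)
    · refine linear_coeff_eq_zero_of_nonneg (c := f₂.eval x₀) fun z => ?_
      simpa [h, add_comm] using hf x₀ 1 z hx₀ (by simp)
  · exact fun hx => Polynomial.sq_X_sub_C_dvd_of_nonneg_on (Icc_mem_nhds hx.1 hx.2) h₂
  · exact fun hx => Polynomial.sq_X_sub_C_dvd_of_nonneg_on (Icc_mem_nhds hx.1 hx.2) h₀
end

section
/- Let r ∈ ℝ[X] with r ≥ 0 on [0,1]. Then there exist sums of squares t, u, v, w in ℝ[X] such that r = t + u·X + v·(1−X) + w·X(1−X) with deg t ≤ deg r, deg(u·X) ≤ deg r, deg(v·(1−X)) ≤ deg r and deg(w·X(1−X)) ≤ deg r. -/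
open Polynomial in
/-- The polynomials `t + u X + v (1 - X) + w X (1 - X)`, with `t, u, v, w` sums of squares and
each of the four terms of degree at most `n`. -/
def TruncatedPreordering (n : ℕ) (p : ℝ[X]) : Prop :=
  ∃ t u v w : ℝ[X], IsSumSq t ∧ IsSumSq u ∧ IsSumSq v ∧ IsSumSq w ∧
    p = t + u * X + v * (1 - X) + w * (X * (1 - X)) ∧
    t.natDegree ≤ n ∧ (u * X).natDegree ≤ n ∧ (v * (1 - X)).natDegree ≤ n ∧
    (w * (X * (1 - X))).natDegree ≤ n

namespace TruncatedPreordering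

open Polynomial

variable {m n : ℕ} {p q : ℝ[X]}

theorem mono (hmn : m ≤ n) (hp : TruncatedPreordering m p) : TruncatedPreordering n p := by
  obtain ⟨t, u, v, w, ht, hu, hv, hw, h, dt, du, dv, dw⟩ := hp
  exact ⟨t, u, v, w, ht, hu, hv, hw, h, dt.trans hmn, du.trans hmn, dv.trans hmn, dw.trans hmn⟩

theorem add (hp : TruncatedPreordering n p) (hq : TruncatedPreordering n q) :
    TruncatedPreordering n (p + q) := by
  obtain ⟨t, u, v, w, ht, hu, hv, hw, rfl, dt, du, dv, dw⟩ := hp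
  obtain ⟨t', u', v', w', ht', hu', hv', hw', rfl, dt', du', dv', dw'⟩ := hq
  refine ⟨t + t', u + u', v + v', w + w', ht.add ht', hu.add hu', hv.add hv', hw.add hw',
    by ring, natDegree_add_le_of_degree_le dt dt', ?_, ?_, ?_⟩
  · rw [add_mul]; exact natDegree_add_le_of_degree_le du du'
  · rw [add_mul]; exact natDegree_add_le_of_degree_le dv dv'
  · rw [add_mul]; exact natDegree_add_le_of_degree_le dw dw'

theorem isSumSq_mul {s : ℝ[X]} (hs : IsSumSq s) (hm : s.natDegree ≤ m)
    (hp : TruncatedPreordering n p) : TruncatedPreordering (m + n) (s * p) := by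
  obtain ⟨t, u, v, w, ht, hu, hv, hw, rfl, dt, du, dv, dw⟩ := hp
  refine ⟨s * t, s * u, s * v, s * w, hs.mul ht, hs.mul hu, hs.mul hv, hs.mul hw,
    by ring, natDegree_mul_le_of_le hm dt, ?_, ?_, ?_⟩
  · rw [mul_assoc]; exact natDegree_mul_le_of_le hm du
  · rw [mul_assoc]; exact natDegree_mul_le_of_le hm dv
  · rw [mul_assoc]; exact natDegree_mul_le_of_le hm dw

theorem X_mul (hp : TruncatedPreordering n p) : TruncatedPreordering (1 + n) (X * p) := by
  obtain ⟨t, u, v, w, ht, hu, hv, hw, rfl, dt, du, dv, dw⟩ := hp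
  have hX : (X : ℝ[X]).natDegree ≤ 1 := natDegree_X_le
  refine ⟨u * (X * X), t, w * (X * X), v, hu.mul (.mul_self X), ht, hw.mul (.mul_self X), hv,
    by ring, ?_, ?_, ?_, ?_⟩
  · convert natDegree_mul_le_of_le hX du using 2; ring
  · convert natDegree_mul_le_of_le hX dt using 2; ring
  · convert natDegree_mul_le_of_le hX dw using 2; ring
  · convert natDegree_mul_le_of_le hX dv using 2; ring

theorem one_sub_X_mul (hp : TruncatedPreordering n p) :
    TruncatedPreordering (1 + n) ((1 - X) * p) := by
  obtain ⟨t, u, v, w, ht, hu, hv, hw, rfl, dt, du, dv, dw⟩ := hp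
  have hX : (1 - X : ℝ[X]).natDegree ≤ 1 := by compute_degree
  refine ⟨v * ((1 - X) * (1 - X)), w * ((1 - X) * (1 - X)), t, u, hv.mul (.mul_self _),
    hw.mul (.mul_self _), ht, hu, by ring, ?_, ?_, ?_, ?_⟩
  · convert natDegree_mul_le_of_le hX dv using 2; ring
  · convert natDegree_mul_le_of_le hX dw using 2; ring
  · convert natDegree_mul_le_of_le hX dt using 2; ring
  · convert natDegree_mul_le_of_le hX du using 2; ring

theorem const_mul {c : ℝ} (hc : 0 ≤ c) (hp : TruncatedPreordering n p) :
    TruncatedPreordering n (C c * p) := by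
  have hs : IsSumSq (C c) := by
    rw [← Real.mul_self_sqrt hc, C_mul]
    exact .mul_self _
  simpa using isSumSq_mul hs (natDegree_C c).le hp

theorem const {c : ℝ} (hc : 0 ≤ c) : TruncatedPreordering 0 (C c) := by
  have h1 : TruncatedPreordering 0 1 :=
    ⟨1, 0, 0, 0, by simp, .zero, .zero, .zero, by simp⟩
  simpa using const_mul hc h1

end TruncatedPreordering

namespace Polynomial

theorem eval_nonneg_of_mul_eval_nonneg {g q : ℝ[X]} (a : ℝ)
    (hg : ∀ x ∈ Set.Icc (0 : ℝ) 1, x ≠ a → 0 < g.eval x)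
    (h : ∀ x ∈ Set.Icc (0 : ℝ) 1, 0 ≤ (g * q).eval x) :
    ∀ x ∈ Set.Icc (0 : ℝ) 1, 0 ≤ q.eval x := by
  have hclosed : IsClosed {x : ℝ | 0 ≤ q.eval x} := isClosed_le continuous_const q.continuous
  have hsub : Set.Ioo (0 : ℝ) 1 ∩ {a}ᶜ ⊆ {x : ℝ | 0 ≤ q.eval x} := fun x hx => by
    have hx' := Set.Ioo_subset_Icc_self hx.1
    have := h x hx'
    rw [eval_mul] at this
    exact nonneg_of_mul_nonneg_right this (hg x hx' hx.2)
  have hIoo : Set.Ioo (0 : ℝ) 1 ⊆ {x : ℝ | 0 ≤ q.eval x} :=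
    ((dense_compl_singleton a).open_subset_closure_inter isOpen_Ioo).trans
      (closure_minimal hsub hclosed)
  have := closure_minimal hIoo hclosed
  rwa [closure_Ioo zero_ne_one] at this

theorem sq_X_sub_C_dvd_of_isLocalMin {r : ℝ[X]} {a : ℝ} (ha : r.IsRoot a)
    (hmin : IsLocalMin (fun x => r.eval x) a) : (X - C a) ^ 2 ∣ r := by
  obtain ⟨q, rfl⟩ := dvd_iff_isRoot.mpr ha
  have hd := hmin.deriv_eq_zero
  rw [Polynomial.deriv] at hd
  have hq : q.IsRoot a := by simpa [derivative_mul] using hd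
  rw [sq]
  exact mul_dvd_mul_left _ (dvd_iff_isRoot.mpr hq)

theorem truncatedPreordering_natDegree {r : ℝ[X]}
    (hr : ∀ x ∈ Set.Icc (0 : ℝ) 1, 0 ≤ r.eval x) : TruncatedPreordering r.natDegree r := by
  induction hn : r.natDegree using Nat.strong_induction_on generalizing r with
  | _ n ih =>
  subst hn
  rcases Nat.eq_zero_or_pos r.natDegree with h0 | hpos
  · obtain ⟨c, rfl⟩ := natDegree_eq_zero.mp h0
    simpa using TruncatedPreordering.const (by simpa using hr 0 (by simp))
  have hr0 : r ≠ 0 := by rintro rfl; simp at hpos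
  /- Every case splits off a factor `g` that is positive on `[0, 1]` away from one point. -/
  have split (g : ℝ[X]) (a : ℝ) (hdvd : g ∣ r) (hg0 : 0 < g.natDegree)
      (hg : ∀ x ∈ Set.Icc (0 : ℝ) 1, x ≠ a → 0 < g.eval x)
      (hmul : ∀ {n : ℕ} {p : ℝ[X]}, TruncatedPreordering n p →
        TruncatedPreordering (g.natDegree + n) (g * p)) :
      TruncatedPreordering r.natDegree r := by
    obtain ⟨q, rfl⟩ := hdvd
    have hdeg := natDegree_mul (left_ne_zero_of_mul hr0) (right_ne_zero_of_mul hr0)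
    rw [hdeg]
    exact hmul (ih _ (by omega) (eval_nonneg_of_mul_eval_nonneg a hg hr) rfl)
  have natDegree_sq_add (a c : ℝ) : ((X - C a) * (X - C a) + C c).natDegree = 2 := by
    compute_degree!
  by_cases hroot : ∃ a, r.IsRoot a
  · obtain ⟨a, ha⟩ := hroot
    have hdvd := dvd_iff_isRoot.mpr ha
    rcases le_or_gt a 0 with ha0 | ha0
    · refine split (X - C a) a hdvd (by simp) ?_ fun {n p} hp => ?_
      · intro x hx hxa
        simpa using lt_of_le_of_ne (ha0.trans hx.1) hxa.symm
      · have h := hp.X_mul.add ((hp.const_mul (neg_nonneg.mpr ha0)).mono (Nat.le_add_left n 1))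
        rw [natDegree_X_sub_C]
        convert h using 1
        simp only [C_neg]; ring
    rcases le_or_gt 1 a with ha1 | ha1
    · refine split (-(X - C a)) a (neg_dvd.mpr hdvd)
        (by rw [natDegree_neg, natDegree_X_sub_C]; exact one_pos) ?_ fun {n p} hp => ?_
      · intro x hx hxa
        simpa using lt_of_le_of_ne (hx.2.trans ha1) hxa
      · have h := hp.one_sub_X_mul.add
          ((hp.const_mul (sub_nonneg.mpr ha1)).mono (Nat.le_add_left n 1))
        rw [natDegree_neg, natDegree_X_sub_C]
        convert h using 1
        simp only [C_sub, C_1]; ring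
    have hmin : IsLocalMin (fun x => r.eval x) a := by
      filter_upwards [Icc_mem_nhds ha0 ha1] with x hx
      rw [ha.eq_zero]
      exact hr x hx
    refine split ((X - C a) ^ 2) a (sq_X_sub_C_dvd_of_isLocalMin ha hmin) (by simp) ?_
      fun hp => TruncatedPreordering.isSumSq_mul (by rw [sq]; exact .mul_self _) le_rfl hp
    intro x _ hxa
    simpa using sq_pos_of_ne_zero (sub_ne_zero.mpr hxa)
  · obtain ⟨z, hz⟩ := IsAlgClosed.exists_aeval_eq_zero ℂ r (natDegree_pos_iff_degree_pos.mp hpos).ne'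
    have him : z.im ≠ 0 := by
      intro h
      refine hroot ⟨z.re, ?_⟩
      have hre : z = algebraMap ℝ ℂ z.re := Complex.ext rfl (by simpa using h)
      rw [hre, aeval_algebraMap_apply_eq_algebraMap_eval] at hz
      simpa using hz
    have hdvd := quadratic_dvd_of_aeval_eq_zero_im_ne_zero r hz him
    have heq : X ^ 2 - C (2 * z.re) * X + C (‖z‖ ^ 2) =
        (X - C z.re) * (X - C z.re) + C (z.im * z.im) := by
      rw [← Complex.normSq_eq_norm_sq, Complex.normSq_apply]
      simp only [C_mul, C_add, C_ofNat]
      ring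
    rw [heq] at hdvd
    refine split _ 0 hdvd (by rw [natDegree_sq_add]; norm_num) ?_ fun hp =>
      TruncatedPreordering.isSumSq_mul (.add (.mul_self _) ?_) le_rfl hp
    · intro x _ _
      have := mul_self_pos.mpr him
      have := mul_self_nonneg (x - z.re)
      simp only [eval_add, eval_mul, eval_sub, eval_X, eval_C]
      linarith
    · rw [C_mul]; exact .mul_self _

end Polynomial

theorem stmt_18 (r : Polynomial ℝ)
    (hr : ∀ x ∈ Set.Icc (0:ℝ) 1, 0 ≤ r.eval x) :
    ∃ t u v w : Polynomial ℝ, IsSumSq t ∧ IsSumSq u ∧ IsSumSq v ∧ IsSumSq w ∧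
      r = t + u * Polynomial.X + v * (1 - Polynomial.X)
        + w * (Polynomial.X * (1 - Polynomial.X)) ∧
      t.degree ≤ r.degree ∧ (u * Polynomial.X).degree ≤ r.degree ∧
      (v * (1 - Polynomial.X)).degree ≤ r.degree ∧
      (w * (Polynomial.X * (1 - Polynomial.X))).degree ≤ r.degree := by
  rcases eq_or_ne r 0 with rfl | hr0
  · exact ⟨0, 0, 0, 0, .zero, .zero, .zero, .zero, by simp⟩
  obtain ⟨t, u, v, w, ht, hu, hv, hw, h, dt, du, dv, dw⟩ :=
    Polynomial.truncatedPreordering_natDegree hr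
  rw [Polynomial.degree_eq_natDegree hr0]
  exact ⟨t, u, v, w, ht, hu, hv, hw, h, Polynomial.degree_le_of_natDegree_le dt,
    Polynomial.degree_le_of_natDegree_le du, Polynomial.degree_le_of_natDegree_le dv,
    Polynomial.degree_le_of_natDegree_le dw⟩
end
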